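/- For every α ∈ [0,1] and every ρ > 0 there exists a constant C > 0 such that the following holds. Let 𝒫 be a finite set of m points in 𝔻² and let ℒ be a finite set of n lines in 𝔻², where each line of ℒ is defined by an equation of the form y = ax + b (with a, b ∈ 𝔻) or of the form x = b (with b ∈ 𝔻), and where for every r ∈ ℝ at most n^α lines of ℒ of the form y = ax + b satisfy Re(a) = r. Then the number of incidences satisfies I(𝒫,ℒ) ≤ C·(m^{2/3+ρ}·n^{(2+α)/3} + m·n^α + n). -/

import Mathlib

attribute [local instance] Classical.propDecidable

/-- The real part of a dual number `a = a₁ + ε a₂`, i.e. `a₁`. -/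
def DRe (x : DualNumber ℝ) : ℝ := TrivSqZeroExt.fst x

/-- A line in the dual plane `𝔻²`, given either by an equation `y = a x + b`
(with `a, b ∈ 𝔻`) or by an equation `x = b` (with `b ∈ 𝔻`). -/
inductive DualLine where
  | slope (a b : DualNumber ℝ) : DualLine
  | vert (b : DualNumber ℝ) : DualLine

/-- The set of points of `𝔻²` lying on a line. -/
def DualLine.pts : DualLine → Set (DualNumber ℝ × DualNumber ℝ)
  | .slope a b => {p | p.2 = a * p.1 + b}
  | .vert b => {p | p.1 = b}

/-- The real part of the slope coefficient `a` of a line `y = a x + b`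
(and `none` for a line `x = b`). -/
def DualLine.slopeRe : DualLine → Option ℝ
  | .slope a _ => some (DRe a)
  | .vert _ => none

/-- The number of incidences `I(𝒫, ℒ)`: the number of pairs `(p, ℓ) ∈ 𝒫 × ℒ` with `p ∈ ℓ`. -/
noncomputable def inc (P : Finset (DualNumber ℝ × DualNumber ℝ)) (L : Finset DualLine) : ℕ :=
  ((P ×ˢ L).filter fun pl => pl.1 ∈ pl.2.pts).card

/-- A segment of the line `y = a x + b` over `[x0, x1]`. -/
@[ext] structure GEdge where
  a : ℝ
  b : ℝ
  x0 : ℝ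
  x1 : ℝ

instance : Inhabited GEdge := ⟨⟨0, 0, 0, 0⟩⟩

def GEdge.h (e : GEdge) (x : ℝ) : ℝ := e.a * x + e.b
def GEdge.lft (e : GEdge) : ℝ × ℝ := (e.x0, e.h e.x0)
def GEdge.rgt (e : GEdge) : ℝ × ℝ := (e.x1, e.h e.x1)
def GEdge.Cross (e f : GEdge) : Prop :=
  ∃ x, e.x0 < x ∧ x < e.x1 ∧ f.x0 < x ∧ x < f.x1 ∧ e.h x = f.h x

lemma affine_zero (a b s t : ℝ) (hst : s < t) (h1 : 0 < a * s + b) (h2 : a * t + b < 0) :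
    ∃ x, s < x ∧ x < t ∧ a * x + b = 0 := by
  have ha : a < 0 := by
    by_contra h
    push Not at h
    nlinarith
  have hb : a * (-b / a) + b = 0 := by
    have := ha.ne
    field_simp
    ring
  refine ⟨-b / a, ?_, ?_, hb⟩ <;> nlinarith

/-- Two segments that do not cross keep their order. -/
lemma order_const (e f : GEdge) (hc : ¬ e.Cross f) (s t : ℝ) (hst : s < t)
    (he0 : e.x0 ≤ s) (hf0 : f.x0 ≤ s) (he1 : t ≤ e.x1) (hf1 : t ≤ f.x1)
    (h : e.h t < f.h t) : e.h s ≤ f.h s := by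
  by_contra hlt
  push Not at hlt
  unfold GEdge.h at h hlt
  obtain ⟨x, hx1, hx2, hx3⟩ := affine_zero (e.a - f.a) (e.b - f.b) s t hst (by linarith)
    (by linarith)
  exact hc ⟨x, by linarith, by linarith, by linarith, by linarith, by unfold GEdge.h; linarith⟩

theorem plane_bound (V : Finset (ℝ × ℝ)) (E : Finset GEdge)
    (hlt : ∀ e ∈ E, e.x0 < e.x1) (hl : ∀ e ∈ E, e.lft ∈ V) (hr : ∀ e ∈ E, e.rgt ∈ V)
    (hC : ∀ e ∈ E, ∀ f ∈ E, e ≠ f → ¬ e.Cross f) : E.card ≤ 4 * V.card := by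
  have same : ∀ e ∈ E, ∀ f ∈ E, e.lft = f.lft → e.a = f.a → e = f := by
    intro e he f hf h1 h2
    by_contra hne
    apply hC e he f hf hne
    have hx : e.x0 = f.x0 := congrArg Prod.fst h1
    have hy : e.h e.x0 = f.h f.x0 := congrArg Prod.snd h1
    have h3 := hlt e he
    have h4 := hlt f hf
    have hm : e.x0 < min e.x1 f.x1 := lt_min h3 (hx ▸ h4)
    have m1 := min_le_left e.x1 f.x1
    have m2 := min_le_right e.x1 f.x1
    refine ⟨(e.x0 + min e.x1 f.x1) / 2, by linarith, by linarith, by linarith, by linarith, ?_⟩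
    unfold GEdge.h at *
    rw [← hx, h2] at hy
    rw [h2]
    linarith
  let U : GEdge → Prop := fun e => ∃ e' ∈ E, e'.lft = e.lft ∧ e.a < e'.a
  have key : ∀ e, (e ∈ E ∧ U e) → ∃ (e' : GEdge) (w : ℝ × ℝ), e' ∈ E ∧ w ∈ V ∧
      e'.lft = e.lft ∧ e.a < e'.a ∧
      (∀ g ∈ E, g.lft = e.lft → e.a < g.a → e'.a ≤ g.a) ∧ e.x0 < w.1 ∧ w.1 ≤ e.x1 ∧
      w.1 ≤ e'.x1 ∧ e.h w.1 ≤ w.2 ∧ w.2 ≤ e'.h w.1 ∧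
      ∀ v ∈ V, e.x0 < v.1 → v.1 ≤ e.x1 → v.1 ≤ e'.x1 → e.h v.1 ≤ v.2 → v.2 ≤ e'.h v.1 →
        w.1 ≤ v.1 := by
    rintro e ⟨he, g, hg, hg1, hg2⟩
    obtain ⟨e', he', hmin⟩ := Finset.exists_min_image
      (E.filter fun g => g.lft = e.lft ∧ e.a < g.a) (fun g => g.a)
      ⟨g, by simp [hg, hg1, hg2]⟩
    simp only [Finset.mem_filter] at he' hmin
    obtain ⟨he'E, hel, hea⟩ := he'
    have hx : e'.x0 = e.x0 := congrArg Prod.fst hel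
    have hy : e'.h e'.x0 = e.h e.x0 := congrArg Prod.snd hel
    have h3 := hlt e he
    have h4 := hlt e' he'E
    have hord : ∀ x, e.x0 ≤ x → e.h x ≤ e'.h x := by
      intro x hxx
      rw [hx] at hy
      unfold GEdge.h at *
      nlinarith
    have hne : (V.filter fun v => e.x0 < v.1 ∧ v.1 ≤ e.x1 ∧ v.1 ≤ e'.x1 ∧ e.h v.1 ≤ v.2 ∧
        v.2 ≤ e'.h v.1).Nonempty := by
      rcases le_total e.x1 e'.x1 with h | h
      · refine ⟨e.rgt, Finset.mem_filter.2 ⟨hr e he, h3, le_rfl, h, le_rfl, ?_⟩⟩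
        exact hord _ h3.le
      · refine ⟨e'.rgt, Finset.mem_filter.2 ⟨hr e' he'E, hx ▸ h4, h, le_rfl, ?_, le_rfl⟩⟩
        exact hord _ (hx ▸ h4.le)
    obtain ⟨w, hw, hwmin⟩ := Finset.exists_min_image _ (fun v : ℝ × ℝ => v.1) hne
    simp only [Finset.mem_filter] at hw hwmin
    obtain ⟨hwV, w1, w2, w3, w4, w5⟩ := hw
    exact ⟨e', w, he'E, hwV, hel, hea, fun g hg h1 h2 => hmin g ⟨hg, h1, h2⟩, w1, w2, w3, w4, w5,
      fun v hv a1 a2 a3 a4 a5 => hwmin v ⟨hv, a1, a2, a3, a4, a5⟩⟩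
  choose! n w hnE hwV hnl hna hnmin w1 w2 w3 w4 w5 hwmin using key
  have main0 : ∀ e f, (e ∈ E ∧ U e) → (f ∈ E ∧ U f) → w e = w f → e.x0 ≤ f.x0 →
      e.h (w e).1 < (n f).h (w e).1 → f.h (w e).1 < (n e).h (w e).1 → e = f := by
    intro e f he hf hw hx h1 h2
    have hnf0 : (n f).x0 = f.x0 := congrArg Prod.fst (hnl f hf)
    have hne0 : (n e).x0 = e.x0 := congrArg Prod.fst (hnl e he)
    have hnfy : (n f).h (n f).x0 = f.h f.x0 := congrArg Prod.snd (hnl f hf)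
    have hney : (n e).h (n e).x0 = e.h e.x0 := congrArg Prod.snd (hnl e he)
    rw [hnf0] at hnfy
    rw [hne0] at hney
    have a1 := w1 f hf
    have a2 := w2 f hf
    have a3 := w3 f hf
    rw [← hw] at a1 a2 a3
    have b2 := w2 e he
    have b3 := w3 e he
    have c1 : e.h f.x0 ≤ (n f).h f.x0 := by
      refine order_const e (n f) (hC _ he.1 _ (hnE f hf) ?_) _ _ a1 hx hnf0.le b2 a3 h1
      intro h
      rw [← h] at h1
      exact lt_irrefl _ h1
    have c2 : f.h f.x0 ≤ (n e).h f.x0 := by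
      refine order_const f (n e) (hC _ hf.1 _ (hnE e he) ?_) _ _ a1 le_rfl (hne0 ▸ hx) a2 b3 h2
      intro h
      rw [← h] at h2
      exact lt_irrefl _ h2
    rw [hnfy] at c1
    have hx' : e.x0 = f.x0 := by
      rcases hx.lt_or_eq with h | h
      · exfalso
        have := hwmin e he f.lft (hl f hf.1) h (by show f.x0 ≤ _; linarith)
          (by show f.x0 ≤ _; linarith) c1 c2
        change _ ≤ f.x0 at this
        linarith
      · exact h
    have hy : e.h e.x0 = f.h f.x0 := by
      rw [← hx'] at c1 c2 ⊢
      rw [hney] at c2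
      linarith
    have hlft : e.lft = f.lft := Prod.ext hx' hy
    have d1 : e.a < (n f).a := by
      rw [← hx'] at hnfy hy a1
      unfold GEdge.h at *
      nlinarith
    have d2 : f.a < (n e).a := by
      rw [← hx'] at hy a1
      unfold GEdge.h at *
      nlinarith
    apply same _ he.1 _ hf.1 hlft
    by_contra hne
    rcases lt_or_gt_of_ne hne with h | h
    · have := hnmin e he f hf.1 hlft.symm h
      linarith
    · have := hnmin f hf e he.1 hlft h
      linarith
  have main : ∀ e f, (e ∈ E ∧ U e) → (f ∈ E ∧ U f) → w e = w f →
      e.h (w e).1 < (n f).h (w e).1 → f.h (w e).1 < (n e).h (w e).1 → e = f := by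
    intro e f he hf hw h1 h2
    rcases le_total e.x0 f.x0 with h | h
    · exact main0 e f he hf hw h h1 h2
    · exact (main0 f e hf he hw.symm h (hw ▸ h2) (hw ▸ h1)).symm
  have strict : ∀ e, (e ∈ E ∧ U e) → e.h (w e).1 < (n e).h (w e).1 := by
    intro e he
    have hne0 : (n e).x0 = e.x0 := congrArg Prod.fst (hnl e he)
    have hney : (n e).h (n e).x0 = e.h e.x0 := congrArg Prod.snd (hnl e he)
    rw [hne0] at hney
    have := w1 e he
    have := hna e he
    unfold GEdge.h at *
    nlinarith
  have hT : (E.filter fun e => ¬ U e).card ≤ V.card := by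
    apply Finset.card_le_card_of_injOn GEdge.lft
    · intro e he
      exact hl e (Finset.mem_filter.1 he).1
    · intro e he f hf hef
      obtain ⟨he, hue⟩ := Finset.mem_filter.1 he
      obtain ⟨hf, huf⟩ := Finset.mem_filter.1 hf
      apply same e he f hf hef
      by_contra hne
      rcases lt_or_gt_of_ne hne with h | h
      · exact hue ⟨f, hf, hef.symm, h⟩
      · exact huf ⟨e, he, hef, h⟩
  have hA : (E.filter fun e => U e ∧ (w e).2 = e.h (w e).1).card ≤ V.card := by
    apply Finset.card_le_card_of_injOn w
    · intro e he
      obtain ⟨he, hue, -⟩ := Finset.mem_filter.1 he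
      exact hwV e ⟨he, hue⟩
    · intro e he f hf hef
      obtain ⟨he, hue, h1⟩ := Finset.mem_filter.1 he
      obtain ⟨hf, huf, h2⟩ := Finset.mem_filter.1 hf
      have s1 := strict e ⟨he, hue⟩
      have s2 := strict f ⟨hf, huf⟩
      rw [← hef] at s2 h2
      exact main e f ⟨he, hue⟩ ⟨hf, huf⟩ hef (by linarith) (by linarith)
  have hB : (E.filter fun e => U e ∧ (w e).2 = (n e).h (w e).1).card ≤ V.card := by
    apply Finset.card_le_card_of_injOn w
    · intro e he
      obtain ⟨he, hue, -⟩ := Finset.mem_filter.1 he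
      exact hwV e ⟨he, hue⟩
    · intro e he f hf hef
      obtain ⟨he, hue, h1⟩ := Finset.mem_filter.1 he
      obtain ⟨hf, huf, h2⟩ := Finset.mem_filter.1 hf
      have s1 := strict e ⟨he, hue⟩
      have s2 := strict f ⟨hf, huf⟩
      rw [← hef] at s2 h2
      exact main e f ⟨he, hue⟩ ⟨hf, huf⟩ hef (by linarith) (by linarith)
  have hD : (E.filter fun e => U e ∧ e.h (w e).1 < (w e).2 ∧ (w e).2 < (n e).h (w e).1).card
      ≤ V.card := by
    apply Finset.card_le_card_of_injOn w
    · intro e he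
      obtain ⟨he, hue, -⟩ := Finset.mem_filter.1 he
      exact hwV e ⟨he, hue⟩
    · intro e he f hf hef
      obtain ⟨he, hue, h1, h1'⟩ := Finset.mem_filter.1 he
      obtain ⟨hf, huf, h2, h2'⟩ := Finset.mem_filter.1 hf
      rw [← hef] at h2 h2'
      exact main e f ⟨he, hue⟩ ⟨hf, huf⟩ hef (by linarith) (by linarith)
  have hsub : E ⊆ (E.filter fun e => ¬ U e) ∪ ((E.filter fun e => U e ∧ (w e).2 = e.h (w e).1) ∪
      ((E.filter fun e => U e ∧ (w e).2 = (n e).h (w e).1) ∪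
      (E.filter fun e => U e ∧ e.h (w e).1 < (w e).2 ∧ (w e).2 < (n e).h (w e).1))) := by
    intro e he
    simp only [Finset.mem_union, Finset.mem_filter, he, true_and]
    by_cases hu : U e
    · have q4 := w4 e ⟨he, hu⟩
      have q5 := w5 e ⟨he, hu⟩
      rcases q4.lt_or_eq with h | h
      · rcases q5.lt_or_eq with h' | h'
        · exact Or.inr (Or.inr (Or.inr ⟨hu, h, h'⟩))
        · exact Or.inr (Or.inr (Or.inl ⟨hu, h'⟩))
      · exact Or.inr (Or.inl ⟨hu, h.symm⟩)
    · exact Or.inl hu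
  have c0 := Finset.card_le_card hsub
  have c1 := Finset.card_union_le (E.filter fun e => ¬ U e)
    ((E.filter fun e => U e ∧ (w e).2 = e.h (w e).1) ∪
      ((E.filter fun e => U e ∧ (w e).2 = (n e).h (w e).1) ∪
      (E.filter fun e => U e ∧ e.h (w e).1 < (w e).2 ∧ (w e).2 < (n e).h (w e).1)))
  have c2 := Finset.card_union_le (E.filter fun e => U e ∧ (w e).2 = e.h (w e).1)
      ((E.filter fun e => U e ∧ (w e).2 = (n e).h (w e).1) ∪
      (E.filter fun e => U e ∧ e.h (w e).1 < (w e).2 ∧ (w e).2 < (n e).h (w e).1))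
  have c3 := Finset.card_union_le (E.filter fun e => U e ∧ (w e).2 = (n e).h (w e).1)
      (E.filter fun e => U e ∧ e.h (w e).1 < (w e).2 ∧ (w e).2 < (n e).h (w e).1)
  omega

lemma wsum (P A : Finset (ℝ × ℝ)) (hA : A ⊆ P) (p : ℝ) :
    ∑ X ∈ P.powerset, (if A ⊆ X then p ^ X.card * (1 - p) ^ (P \ X).card else 0) = p ^ A.card := by
  have h := Finset.prod_add (fun _ => p) (fun i => if i ∈ A then 0 else 1 - p) P
  have h1 : ∏ i ∈ P, (p + if i ∈ A then 0 else 1 - p) = p ^ A.card := by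
    have : ∀ i ∈ P, (p + if i ∈ A then 0 else 1 - p) = if i ∈ A then p else 1 := by
      intro i _
      split_ifs <;> ring
    rw [Finset.prod_congr rfl this, Finset.prod_ite_mem, Finset.inter_eq_right.2 hA,
      Finset.prod_const]
  rw [h1] at h
  rw [h]
  apply Finset.sum_congr rfl
  intro X hX
  rw [Finset.mem_powerset] at hX
  rw [Finset.prod_const]
  split_ifs with hAX
  · congr 1
    rw [← Finset.prod_const]
    apply Finset.prod_congr rfl
    intro i hi
    rw [if_neg]
    intro hiA
    exact (Finset.mem_sdiff.1 hi).2 (hAX hiA)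
  · obtain ⟨i, hiA, hiX⟩ := Finset.not_subset.1 hAX
    rw [Finset.prod_eq_zero (i := i) (Finset.mem_sdiff.2 ⟨hA hiA, hiX⟩) (by simp [hiA])]
    simp

lemma wsum_card {ι : Type} (P : Finset (ℝ × ℝ)) (S : Finset ι) (A : ι → Finset (ℝ × ℝ))
    (hA : ∀ s ∈ S, A s ⊆ P) (p : ℝ) (k : ℕ) (hk : ∀ s ∈ S, (A s).card = k) :
    ∑ X ∈ P.powerset, p ^ X.card * (1 - p) ^ (P \ X).card *
      ((S.filter fun s => A s ⊆ X).card : ℝ) = S.card * p ^ k := by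
  have : ∀ X ∈ P.powerset, p ^ X.card * (1 - p) ^ (P \ X).card *
      ((S.filter fun s => A s ⊆ X).card : ℝ) =
      ∑ s ∈ S, if A s ⊆ X then p ^ X.card * (1 - p) ^ (P \ X).card else 0 := by
    intro X _
    rw [Finset.card_filter]
    push_cast
    rw [Finset.mul_sum]
    apply Finset.sum_congr rfl
    intro s _
    split_ifs <;> simp
  rw [Finset.sum_congr rfl this, Finset.sum_comm]
  rw [Finset.sum_congr rfl (fun s hs => (wsum P (A s) (hA s hs) p).trans (by rw [hk s hs]))]
  simp

theorem cross_amp (P : Finset (ℝ × ℝ)) (E : Finset GEdge)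
    (hlt : ∀ e ∈ E, e.x0 < e.x1) (hl : ∀ e ∈ E, e.lft ∈ P) (hr : ∀ e ∈ E, e.rgt ∈ P)
    (Cr : Finset (GEdge × GEdge))
    (hCr : Cr = (E ×ˢ E).filter fun c => c.1 ≠ c.2 ∧ c.1.Cross c.2)
    (hd : ∀ c ∈ Cr, ({c.1.lft, c.1.rgt, c.2.lft, c.2.rgt} : Finset (ℝ × ℝ)).card = 4)
    (p : ℝ) (hp0 : 0 ≤ p) (hp1 : p ≤ 1) :
    (E.card : ℝ) * p ^ 2 ≤ 4 * (P.card * p) + Cr.card * p ^ 4 := by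
  have hCrm : ∀ c ∈ Cr, c.1 ∈ E ∧ c.2 ∈ E := by
    intro c hc
    rw [hCr] at hc
    exact Finset.mem_product.1 (Finset.mem_filter.1 hc).1
  have e1 := wsum_card P E (fun e => {e.lft, e.rgt})
    (by
      intro e he x hx
      simp only [Finset.mem_insert, Finset.mem_singleton] at hx
      rcases hx with rfl | rfl
      · exact hl e he
      · exact hr e he) p 2
    (by
      intro e he
      apply Finset.card_pair
      intro h
      exact (hlt e he).ne (congrArg Prod.fst h))
  have e2 := wsum_card P P (fun v => {v}) (by simp) p 1 (by simp)
  have e3 := wsum_card P Cr (fun c => {c.1.lft, c.1.rgt, c.2.lft, c.2.rgt})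
    (by
      intro c hc x hx
      obtain ⟨h1, h2⟩ := hCrm c hc
      simp only [Finset.mem_insert, Finset.mem_singleton] at hx
      rcases hx with rfl | rfl | rfl | rfl
      · exact hl _ h1
      · exact hr _ h1
      · exact hl _ h2
      · exact hr _ h2) p 4 hd
  rw [pow_one] at e2
  rw [← e1, ← e2, ← e3, Finset.mul_sum, ← Finset.sum_add_distrib]
  apply Finset.sum_le_sum
  intro X hX
  have hXP := Finset.mem_powerset.1 hX
  have hw : 0 ≤ p ^ X.card * (1 - p) ^ (P \ X).card := by
    have : 0 ≤ 1 - p := by linarith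
    positivity
  have hcard : (E.filter fun e => ({e.lft, e.rgt} : Finset (ℝ × ℝ)) ⊆ X).card ≤
      4 * (P.filter fun v => ({v} : Finset (ℝ × ℝ)) ⊆ X).card +
      (Cr.filter fun c => ({c.1.lft, c.1.rgt, c.2.lft, c.2.rgt} : Finset (ℝ × ℝ)) ⊆ X).card := by
    set EX := E.filter fun e => ({e.lft, e.rgt} : Finset (ℝ × ℝ)) ⊆ X with hEX
    set CX := Cr.filter fun c => ({c.1.lft, c.1.rgt, c.2.lft, c.2.rgt} : Finset (ℝ × ℝ)) ⊆ X
      with hCX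
    have hPX : (P.filter fun v => ({v} : Finset (ℝ × ℝ)) ⊆ X) = X := by
      ext v
      simp only [Finset.mem_filter, Finset.singleton_subset_iff]
      exact ⟨fun h => h.2, fun h => ⟨hXP h, h⟩⟩
    rw [hPX]
    have hmem : ∀ e ∈ EX, e ∈ E ∧ e.lft ∈ X ∧ e.rgt ∈ X := by
      intro e he
      obtain ⟨h1, h2⟩ := Finset.mem_filter.1 he
      exact ⟨h1, h2 (by simp), h2 (by simp)⟩
    have hpl := plane_bound X (EX \ CX.image Prod.fst)
      (fun e he => hlt e (hmem e (Finset.mem_sdiff.1 he).1).1)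
      (fun e he => (hmem e (Finset.mem_sdiff.1 he).1).2.1)
      (fun e he => (hmem e (Finset.mem_sdiff.1 he).1).2.2)
      (by
        intro e he f hf hne hc
        obtain ⟨he1, he2⟩ := Finset.mem_sdiff.1 he
        obtain ⟨hf1, hf2⟩ := Finset.mem_sdiff.1 hf
        apply he2
        refine Finset.mem_image.2 ⟨(e, f), ?_, rfl⟩
        obtain ⟨a1, a2, a3⟩ := hmem e he1
        obtain ⟨b1, b2, b3⟩ := hmem f hf1
        rw [hCX, hCr]
        simp only [Finset.mem_filter, Finset.mem_product]
        refine ⟨⟨⟨a1, b1⟩, hne, hc⟩, ?_⟩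
        intro x hx
        simp only [Finset.mem_insert, Finset.mem_singleton] at hx
        rcases hx with rfl | rfl | rfl | rfl <;> assumption)
    have h1 := Finset.card_image_le (s := CX) (f := Prod.fst)
    have h2 := Finset.le_card_sdiff (CX.image Prod.fst) EX
    omega
  have hcard' : ((E.filter fun e => ({e.lft, e.rgt} : Finset (ℝ × ℝ)) ⊆ X).card : ℝ) ≤
      4 * (P.filter fun v => ({v} : Finset (ℝ × ℝ)) ⊆ X).card +
      (Cr.filter fun c => ({c.1.lft, c.1.rgt, c.2.lft, c.2.rgt} : Finset (ℝ × ℝ)) ⊆ X).card := by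
    exact_mod_cast hcard
  have := mul_le_mul_of_nonneg_left hcard' hw
  linarith

/-- Real incidences. -/
noncomputable def rinc (P L : Finset (ℝ × ℝ)) : ℕ :=
  ((P ×ˢ L).filter fun c => c.1.2 = c.2.1 * c.1.1 + c.2.2).card

theorem real_edges (P L : Finset (ℝ × ℝ)) :
    ∃ e : ℕ, rinc P L ≤ e + L.card ∧ ∀ p : ℝ, 0 ≤ p → p ≤ 1 →
      (e : ℝ) * p ^ 2 ≤ 4 * (P.card * p) + (L.card : ℝ) ^ 2 * p ^ 4 := by
  let inc : (ℝ × ℝ) → (ℝ × ℝ) → Prop := fun q l => q.2 = l.1 * q.1 + l.2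
  let N : Finset ((ℝ × ℝ) × (ℝ × ℝ)) :=
    (P ×ˢ L).filter fun c => inc c.1 c.2 ∧ ∃ q ∈ P, inc q c.2 ∧ c.1.1 < q.1
  let M : Finset ((ℝ × ℝ) × (ℝ × ℝ)) :=
    (P ×ˢ L).filter fun c => inc c.1 c.2 ∧ ¬ ∃ q ∈ P, inc q c.2 ∧ c.1.1 < q.1
  have hM : M.card ≤ L.card := by
    apply Finset.card_le_card_of_injOn Prod.snd
    · intro c hc
      exact (Finset.mem_product.1 (Finset.mem_filter.1 hc).1).2
    · intro c hc d hd hcd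
      obtain ⟨c1, c2, c3⟩ := Finset.mem_filter.1 hc
      obtain ⟨d1, d2, d3⟩ := Finset.mem_filter.1 hd
      have c0 := (Finset.mem_product.1 c1).1
      have d0 := (Finset.mem_product.1 d1).1
      have hx : c.1.1 = d.1.1 := by
        by_contra hne
        rcases lt_or_gt_of_ne hne with h | h
        · exact c3 ⟨d.1, d0, hcd ▸ d2, h⟩
        · exact d3 ⟨c.1, c0, hcd ▸ c2, h⟩
      refine Prod.ext (Prod.ext hx ?_) hcd
      change c.1.2 = _ at c2
      change d.1.2 = _ at d2
      rw [c2, d2, hx, hcd]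
  have hNM : rinc P L ≤ N.card + M.card := by
    unfold rinc
    refine le_trans (Finset.card_le_card ?_) (Finset.card_union_le N M)
    intro c hc
    obtain ⟨c1, c2⟩ := Finset.mem_filter.1 hc
    by_cases h : ∃ q ∈ P, inc q c.2 ∧ c.1.1 < q.1
    · exact Finset.mem_union_left _ (Finset.mem_filter.2 ⟨c1, c2, h⟩)
    · exact Finset.mem_union_right _ (Finset.mem_filter.2 ⟨c1, c2, h⟩)
  refine ⟨N.card, by omega, ?_⟩
  have key : ∀ c, c ∈ N → ∃ q, q ∈ P ∧ inc q c.2 ∧ c.1.1 < q.1 ∧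
      ∀ r ∈ P, inc r c.2 → c.1.1 < r.1 → q.1 ≤ r.1 := by
    intro c hc
    obtain ⟨c1, c2, q, hq, hq1, hq2⟩ := Finset.mem_filter.1 hc
    obtain ⟨r, hr, hmin⟩ := Finset.exists_min_image
      (P.filter fun q => inc q c.2 ∧ c.1.1 < q.1) (fun q => q.1)
      ⟨q, Finset.mem_filter.2 ⟨hq, hq1, hq2⟩⟩
    obtain ⟨r1, r2, r3⟩ := Finset.mem_filter.1 hr
    exact ⟨r, r1, r2, r3, fun s hs h1 h2 => hmin s (Finset.mem_filter.2 ⟨hs, h1, h2⟩)⟩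
  choose! nx nxP nxi nxlt nxmin using key
  let φ : (ℝ × ℝ) × (ℝ × ℝ) → GEdge := fun c => ⟨c.2.1, c.2.2, c.1.1, (nx c).1⟩
  have hNm : ∀ c ∈ N, c.1 ∈ P ∧ c.2 ∈ L ∧ inc c.1 c.2 := by
    intro c hc
    obtain ⟨c1, c2, -⟩ := Finset.mem_filter.1 hc
    exact ⟨(Finset.mem_product.1 c1).1, (Finset.mem_product.1 c1).2, c2⟩
  have φl : ∀ c ∈ N, (φ c).lft = c.1 := fun c hc => Prod.ext rfl (hNm c hc).2.2.symm
  have φr : ∀ c ∈ N, (φ c).rgt = nx c := fun c hc => Prod.ext rfl (nxi c hc).symm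
  have φinj : Set.InjOn φ N := by
    intro c hc d hd h
    have h1 : c.2.1 = d.2.1 := congrArg GEdge.a h
    have h2 : c.2.2 = d.2.2 := congrArg GEdge.b h
    have h3 : c.1 = d.1 := by rw [← φl c hc, ← φl d hd, h]
    exact Prod.ext h3 (Prod.ext h1 h2)
  have hcardE : (N.image φ).card = N.card := Finset.card_image_of_injOn φinj
  -- two edges on the same line with a common interior abscissa coincide
  have hsame : ∀ c ∈ N, ∀ d ∈ N, c.2 = d.2 → ∀ x, c.1.1 < x → x < (nx c).1 → d.1.1 < x →
      x < (nx d).1 → c = d := by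
    intro c hc d hd hcd x x1 x2 x3 x4
    have hx : c.1.1 = d.1.1 := by
      by_contra hne
      rcases lt_or_gt_of_ne hne with h | h
      · have := nxmin c hc d.1 (hNm d hd).1 (hcd ▸ (hNm d hd).2.2) h
        linarith
      · have := nxmin d hd c.1 (hNm c hc).1 (hcd ▸ (hNm c hc).2.2) h
        linarith
    refine Prod.ext (Prod.ext hx ?_) hcd
    have c2 := (hNm c hc).2.2
    have d2 := (hNm d hd).2.2
    change c.1.2 = _ at c2
    change d.1.2 = _ at d2
    rw [c2, d2, hx, hcd]
  have huniq : ∀ l l' : ℝ × ℝ, l ≠ l' → ∀ x y, l.1 * x + l.2 = l'.1 * x + l'.2 →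
      l.1 * y + l.2 = l'.1 * y + l'.2 → x = y := by
    intro l l' hne x y hx hy
    by_contra hxy
    apply hne
    have h1 : (l.1 - l'.1) * (x - y) = 0 := by linarith
    have h2 : l.1 = l'.1 := by
      rcases mul_eq_zero.1 h1 with h | h
      · linarith
      · exact absurd (by linarith) hxy
    rw [h2] at hx
    exact Prod.ext h2 (by linarith)
  let Cr := ((N.image φ) ×ˢ (N.image φ)).filter fun c => c.1 ≠ c.2 ∧ c.1.Cross c.2
  have hCrcard : Cr.card ≤ L.card ^ 2 := by
    rw [sq, ← Finset.card_product]
    apply Finset.card_le_card_of_injOn (fun c => ((c.1.a, c.1.b), (c.2.a, c.2.b)))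
    · intro c hc
      obtain ⟨c1, -⟩ := Finset.mem_filter.1 hc
      obtain ⟨c1, c2⟩ := Finset.mem_product.1 c1
      obtain ⟨d, hd, hd'⟩ := Finset.mem_image.1 c1
      obtain ⟨d2, hd2, hd2'⟩ := Finset.mem_image.1 c2
      refine Finset.mem_coe.2 (Finset.mem_product.2 ⟨?_, ?_⟩)
      · show (c.1.a, c.1.b) ∈ L
        rw [← hd']
        exact (hNm d hd).2.1
      · show (c.2.a, c.2.b) ∈ L
        rw [← hd2']
        exact (hNm d2 hd2).2.1
    · rintro ⟨c, d⟩ hc ⟨c', d'⟩ hc' heq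
      obtain ⟨c1, cne, x, x1, x2, x3, x4, x5⟩ := Finset.mem_filter.1 hc
      obtain ⟨c1', cne', x', x1', x2', x3', x4', x5'⟩ := Finset.mem_filter.1 hc'
      obtain ⟨c1, c2⟩ := Finset.mem_product.1 c1
      obtain ⟨c1', c2'⟩ := Finset.mem_product.1 c1'
      obtain ⟨s, hs, rfl⟩ := Finset.mem_image.1 c1
      obtain ⟨t, ht, rfl⟩ := Finset.mem_image.1 c2
      obtain ⟨s', hs', rfl⟩ := Finset.mem_image.1 c1'
      obtain ⟨t', ht', rfl⟩ := Finset.mem_image.1 c2'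
      change (s.2, t.2) = (s'.2, t'.2) at heq
      have hss : s.2 = s'.2 := (Prod.mk.inj heq).1
      have htt : t.2 = t'.2 := (Prod.mk.inj heq).2
      have hst : s.2 ≠ t.2 := by
        intro h
        apply cne
        show φ s = φ t
        rw [hsame s hs t ht h x x1 x2 x3 x4]
      have hxx : x = x' := by
        apply huniq s.2 t.2 hst x x' x5
        rw [hss, htt]
        exact x5'
      subst hxx
      have g1 := hsame s hs s' hs' hss x x1 x2 x1' x2'
      have g2 := hsame t ht t' ht' htt x x3 x4 x3' x4'
      rw [g1, g2]
  intro p hp0 hp1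
  have := cross_amp P (N.image φ)
    (by
      intro e he
      obtain ⟨c, hc, rfl⟩ := Finset.mem_image.1 he
      exact nxlt c hc)
    (by
      intro e he
      obtain ⟨c, hc, rfl⟩ := Finset.mem_image.1 he
      rw [φl c hc]
      exact (hNm c hc).1)
    (by
      intro e he
      obtain ⟨c, hc, rfl⟩ := Finset.mem_image.1 he
      rw [φr c hc]
      exact nxP c hc) Cr rfl
    (by
      rintro ⟨c, d⟩ hc
      obtain ⟨c1, cne, x, x1, x2, x3, x4, x5⟩ := Finset.mem_filter.1 hc
      obtain ⟨c1, c2⟩ := Finset.mem_product.1 c1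
      obtain ⟨s, hs, rfl⟩ := Finset.mem_image.1 c1
      obtain ⟨t, ht, rfl⟩ := Finset.mem_image.1 c2
      have hst : s.2 ≠ t.2 := by
        intro h
        apply cne
        show φ s = φ t
        rw [hsame s hs t ht h x x1 x2 x3 x4]
      have hz : ∀ z, (φ s).h z = (φ t).h z → x = z := fun z hz => huniq s.2 t.2 hst x z x5 hz
      dsimp only at x1 x2 x3 x4 ⊢
      have n1 : (φ s).lft ≠ (φ s).rgt := fun h => (nxlt s hs).ne (Prod.mk.inj h).1
      have n2 : (φ t).lft ≠ (φ t).rgt := fun h => (nxlt t ht).ne (Prod.mk.inj h).1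
      have gen : ∀ z z', x ≠ z → (z, (φ s).h z) ≠ (z', (φ t).h z') := by
        intro z z' hne h
        have h1 : z = z' := congrArg Prod.fst h
        subst h1
        exact hne (hz z (congrArg Prod.snd h))
      have n3 : (φ s).lft ≠ (φ t).lft := gen _ _ x1.ne'
      have n4 : (φ s).lft ≠ (φ t).rgt := gen _ _ x1.ne'
      have n5 : (φ s).rgt ≠ (φ t).lft := gen _ _ x2.ne
      have n6 : (φ s).rgt ≠ (φ t).rgt := gen _ _ x2.ne
      rw [Finset.card_insert_of_notMem, Finset.card_insert_of_notMem, Finset.card_pair n2]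
      · simp [n5, n6]
      · simp [n1, n3, n4]) p hp0 hp1
  rw [hcardE] at this
  have h2 : (Cr.card : ℝ) ≤ (L.card : ℝ) ^ 2 := by exact_mod_cast hCrcard
  have h3 := mul_le_mul_of_nonneg_right h2 (by positivity : 0 ≤ p ^ 4)
  linarith

/-- The Szemerédi–Trotter bound in the real plane (non-vertical lines). -/
theorem real_st (P L : Finset (ℝ × ℝ)) :
    (rinc P L : ℝ) ≤ 8 * ((P.card : ℝ) ^ (2/3 : ℝ) * (L.card : ℝ) ^ (2/3 : ℝ) + P.card + L.card) := by
  obtain ⟨e, he, h⟩ := real_edges P L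
  have he' : (rinc P L : ℝ) ≤ e + L.card := by exact_mod_cast he
  set m : ℝ := (P.card : ℝ) with hm
  set n : ℝ := (L.card : ℝ) with hn
  have hm0 : 0 ≤ m := Nat.cast_nonneg _
  have hn0 : 0 ≤ n := Nat.cast_nonneg _
  have hpos : 0 ≤ m ^ (2/3 : ℝ) * n ^ (2/3 : ℝ) := by positivity
  suffices hs : (e : ℝ) ≤ 8 * (m ^ (2/3 : ℝ) * n ^ (2/3 : ℝ)) + 8 * m by linarith
  rcases le_or_gt (e : ℝ) (8 * m) with h1 | h1
  · linarith
  have hepos : (0 : ℝ) < e := by linarith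
  suffices hs : (e : ℝ) ≤ 8 * (m ^ (2/3 : ℝ) * n ^ (2/3 : ℝ)) by linarith
  have h2 := h (8 * m / e) (by positivity) (by rw [div_le_one hepos]; exact h1.le)
  have hcube : (e : ℝ) ^ 3 ≤ (8 * (m ^ (2/3 : ℝ) * n ^ (2/3 : ℝ))) ^ 3 := by
    have r1 : ∀ t : ℝ, 0 ≤ t → (t ^ (2/3 : ℝ)) ^ 3 = t ^ 2 := by
      intro t ht
      rw [← Real.rpow_natCast, ← Real.rpow_mul ht, ← Real.rpow_natCast]
      norm_num
    rw [mul_pow, mul_pow, r1 m hm0, r1 n hn0]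
    rcases hm0.eq_or_lt with h0 | h0
    · rw [← h0] at h2
      have h5 := h 1 zero_le_one le_rfl
      have h6 := h (1 / (1 + n)) (by positivity) (by rw [div_le_one (by positivity)]; linarith)
      rw [← h0] at h6
      have hq : 0 < 1 / (1 + n) := by positivity
      have h7 : (e : ℝ) ≤ n ^ 2 * (1 / (1 + n)) ^ 2 := by
        have : (e : ℝ) * (1 / (1 + n)) ^ 2 ≤ (n ^ 2 * (1 / (1 + n)) ^ 2) * (1 / (1 + n)) ^ 2 := by
          linarith
        exact le_of_mul_le_mul_right this (by positivity)
      have h8 : n ^ 2 * (1 / (1 + n)) ^ 2 < 1 := by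
        rw [← mul_pow, mul_one_div]
        have : n / (1 + n) < 1 := by rw [div_lt_one (by positivity)]; linarith
        have h9 : 0 ≤ n / (1 + n) := by positivity
        nlinarith
      have : (e : ℝ) < 1 := by linarith
      have : e < 1 := by exact_mod_cast this
      have : e = 0 := by omega
      rw [this] at hepos
      simp at hepos
    · have k1 : (e : ℝ) * (8 * m / e) ^ 2 = 64 * m ^ 2 / e := by field_simp; ring
      have k2 : 4 * (m * (8 * m / e)) = 32 * m ^ 2 / e := by field_simp; ring
      have k3 : n ^ 2 * (8 * m / e) ^ 4 = 4096 * n ^ 2 * m ^ 4 / e ^ 4 := by field_simp; ring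
      rw [k1, k2, k3] at h2
      have k4 : 32 * m ^ 2 / e ≤ 4096 * n ^ 2 * m ^ 4 / e ^ 4 := by
        have : 64 * m ^ 2 / e = 32 * m ^ 2 / e + 32 * m ^ 2 / (e : ℝ) := by ring
        linarith
      rw [div_le_div_iff₀ hepos (by positivity)] at k4
      have k5 : (e : ℝ) ^ 3 * (32 * m ^ 2 * e) ≤ (128 * (m ^ 2 * n ^ 2)) * (32 * m ^ 2 * e) := by
        linarith
      have k6 := le_of_mul_le_mul_right k5 (by positivity)
      have : 0 ≤ m ^ 2 * n ^ 2 := by positivity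
      linarith
  exact le_of_pow_le_pow_left₀ (by norm_num) (by positivity) hcube

lemma holder_sum {ι : Type} (s : Finset ι) (f g : ι → ℝ) (hf : ∀ i ∈ s, 0 ≤ f i)
    (hg : ∀ i ∈ s, 0 ≤ g i) :
    ∑ i ∈ s, f i ^ (2/3 : ℝ) * g i ^ (2/3 : ℝ) ≤
      (∑ i ∈ s, f i) ^ (2/3 : ℝ) * (∑ i ∈ s, g i ^ 2) ^ (1/3 : ℝ) := by
  have hpq : (3/2 : ℝ).HolderConjugate 3 := by
    rw [Real.holderConjugate_iff]; norm_num
  have h := Real.inner_le_Lp_mul_Lq_of_nonneg s (f := fun i => f i ^ (2/3 : ℝ))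
    (g := fun i => g i ^ (2/3 : ℝ)) hpq (fun i hi => Real.rpow_nonneg (hf i hi) _)
    (fun i hi => Real.rpow_nonneg (hg i hi) _)
  have h1 : ∑ i ∈ s, (f i ^ (2/3 : ℝ)) ^ (3/2 : ℝ) = ∑ i ∈ s, f i := by
    apply Finset.sum_congr rfl
    intro i hi
    rw [← Real.rpow_mul (hf i hi)]
    norm_num
  have h2 : ∑ i ∈ s, (g i ^ (2/3 : ℝ)) ^ (3 : ℝ) = ∑ i ∈ s, g i ^ 2 := by
    apply Finset.sum_congr rfl
    intro i hi
    rw [← Real.rpow_mul (hg i hi), ← Real.rpow_natCast]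
    norm_num
  rw [h1, h2] at h
  have h3 : (1 / (3/2) : ℝ) = 2/3 := by norm_num
  rwa [h3] at h

/-- Incidences of dual points with dual lines `y = A l * x + B l`. -/
noncomputable def dinc {ι : Type} (P : Finset (DualNumber ℝ × DualNumber ℝ)) (L : Finset ι)
    (A B : ι → DualNumber ℝ) : ℕ :=
  ((P ×ˢ L).filter fun c => c.1.2 = A c.2 * c.1.1 + B c.2).card

lemma real_st' (P L : Finset (ℝ × ℝ)) (m n : ℕ) (hm : P.card ≤ m) (hn : L.card ≤ n) :
    (rinc P L : ℝ) ≤ 8 * ((m : ℝ) ^ (2/3 : ℝ) * (n : ℝ) ^ (2/3 : ℝ) + m + n) := by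
  have hm' : (P.card : ℝ) ≤ m := by exact_mod_cast hm
  have hn' : (L.card : ℝ) ≤ n := by exact_mod_cast hn
  refine (real_st P L).trans ?_
  gcongr

lemma analytic (m n T X Y : ℝ) (hm0 : 0 ≤ m) (hn0 : 0 ≤ n)
    (hT : T = m ^ (2/3 : ℝ) * n ^ (2/3 : ℝ) + m + n) (hY : 0 ≤ Y) (hk2 : Y ≤ 8 * T + n ^ 2)
    (hh : X ≤ m ^ (2/3 : ℝ) * Y ^ (1/3 : ℝ)) : X ≤ 3 * T := by
  have hpos : 0 ≤ m ^ (2/3 : ℝ) * n ^ (2/3 : ℝ) := by positivity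
  have hT0 : 0 ≤ T := by rw [hT]; positivity
  have q1 : Y ^ (1/3 : ℝ) ≤
      (8 * T) ^ (1/3 : ℝ) + (n ^ 2) ^ (1/3 : ℝ) := by
    refine (Real.rpow_le_rpow hY hk2 (by norm_num)).trans ?_
    exact Real.rpow_add_le_add_rpow (by positivity) (by positivity) (by norm_num) (by norm_num)
  have q2 : (n ^ 2) ^ (1/3 : ℝ) = n ^ (2/3 : ℝ) := by
    rw [← Real.rpow_natCast, ← Real.rpow_mul hn0]
    norm_num
  have q3 : (8 * T) ^ (1/3 : ℝ) = 2 * T ^ (1/3 : ℝ) := by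
    rw [Real.mul_rpow (by norm_num) hT0]
    have : (8 : ℝ) = 2 ^ (3 : ℝ) := by norm_num
    rw [this, ← Real.rpow_mul (by norm_num)]
    norm_num
  have q4 : m ^ (2/3 : ℝ) ≤ T ^ (2/3 : ℝ) :=
    Real.rpow_le_rpow hm0 (by linarith) (by norm_num)
  have q5 : T ^ (2/3 : ℝ) * T ^ (1/3 : ℝ) = T := by
    rw [← Real.rpow_add_of_nonneg hT0 (by norm_num) (by norm_num)]
    norm_num
  have q6 : m ^ (2/3 : ℝ) * T ^ (1/3 : ℝ) ≤ T := by
    calc _ ≤ T ^ (2/3 : ℝ) * T ^ (1/3 : ℝ) := by gcongr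
      _ = T := q5
  rw [q2, q3] at q1
  calc _ ≤ _ := hh
    _ ≤ m ^ (2/3 : ℝ) * (2 * T ^ (1/3 : ℝ) + n ^ (2/3 : ℝ)) := by gcongr
    _ = 2 * (m ^ (2/3 : ℝ) * T ^ (1/3 : ℝ)) + m ^ (2/3 : ℝ) * n ^ (2/3 : ℝ) := by ring
    _ ≤ 3 * T := by linarith

set_option maxHeartbeats 1000000 in
theorem dual_distinct {ι : Type} (P : Finset (DualNumber ℝ × DualNumber ℝ)) (L : Finset ι)
    (A B : ι → DualNumber ℝ)
    (hinj : ∀ l ∈ L, ∀ l' ∈ L, TrivSqZeroExt.fst (A l) = TrivSqZeroExt.fst (A l') → l = l') :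
    (dinc P L A B : ℝ) ≤
      96 * ((P.card : ℝ) ^ (2/3 : ℝ) * (L.card : ℝ) ^ (2/3 : ℝ) + P.card + L.card) := by
  let π : DualNumber ℝ × DualNumber ℝ → ℝ × ℝ := fun p =>
    (TrivSqZeroExt.fst p.1, TrivSqZeroExt.fst p.2)
  let σ : DualNumber ℝ × DualNumber ℝ → ℝ × ℝ := fun p =>
    (TrivSqZeroExt.snd p.1, TrivSqZeroExt.snd p.2)
  let Q := P.image π
  let Pq : ℝ × ℝ → Finset (DualNumber ℝ × DualNumber ℝ) := fun q => P.filter fun p => π p = q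
  let Lq : ℝ × ℝ → Finset ι := fun q => L.filter fun l =>
    q.2 = TrivSqZeroExt.fst (A l) * q.1 + TrivSqZeroExt.fst (B l)
  let τ : ℝ × ℝ → ι → ℝ × ℝ := fun q l =>
    (TrivSqZeroExt.fst (A l), TrivSqZeroExt.snd (A l) * q.1 + TrivSqZeroExt.snd (B l))
  have hinc : ∀ (p : DualNumber ℝ × DualNumber ℝ) (l : ι), p.2 = A l * p.1 + B l →
      (π p).2 = TrivSqZeroExt.fst (A l) * (π p).1 + TrivSqZeroExt.fst (B l) ∧
      (σ p).2 = (τ (π p) l).1 * (σ p).1 + (τ (π p) l).2 := by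
    intro p l h
    constructor
    · show TrivSqZeroExt.fst p.2 = _
      rw [h]
      simp [π]
    · show TrivSqZeroExt.snd p.2 = _
      rw [h]
      simp [π, σ, τ]
      ring
  have h1 : dinc P L A B = ∑ q ∈ Q, (((P ×ˢ L).filter fun c => c.1.2 = A c.2 * c.1.1 + B c.2).filter
      fun c => π c.1 = q).card := by
    apply Finset.card_eq_sum_card_fiberwise
    intro c hc
    have := (Finset.mem_product.1 (Finset.mem_filter.1 hc).1).1
    exact Finset.mem_coe.2 (Finset.mem_image_of_mem π this)
  have h2 : ∀ q ∈ Q, (((P ×ˢ L).filter fun c => c.1.2 = A c.2 * c.1.1 + B c.2).filter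
      fun c => π c.1 = q).card ≤ rinc ((Pq q).image σ) ((Lq q).image (τ q)) := by
    intro q _
    unfold rinc
    apply Finset.card_le_card_of_injOn (fun c => (σ c.1, τ q c.2))
    · intro c hc
      obtain ⟨hc, hq⟩ := Finset.mem_filter.1 hc
      obtain ⟨hc, hi⟩ := Finset.mem_filter.1 hc
      obtain ⟨hP, hL⟩ := Finset.mem_product.1 hc
      obtain ⟨i1, i2⟩ := hinc c.1 c.2 hi
      rw [hq] at i1 i2
      refine Finset.mem_coe.2 (Finset.mem_filter.2 ⟨Finset.mem_product.2 ⟨?_, ?_⟩, i2⟩)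
      · exact Finset.mem_image_of_mem σ (Finset.mem_filter.2 ⟨hP, hq⟩)
      · exact Finset.mem_image_of_mem (τ q) (Finset.mem_filter.2 ⟨hL, i1⟩)
    · intro c hc d hd hcd
      obtain ⟨hc, hcq⟩ := Finset.mem_filter.1 hc
      obtain ⟨hd, hdq⟩ := Finset.mem_filter.1 hd
      obtain ⟨hc, -⟩ := Finset.mem_filter.1 hc
      obtain ⟨hd, -⟩ := Finset.mem_filter.1 hd
      obtain ⟨e1, e2⟩ := Prod.mk.inj hcd
      have e3 : π c.1 = π d.1 := hcq.trans hdq.symm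
      obtain ⟨s1, s2⟩ := Prod.mk.inj e1
      obtain ⟨s3, s4⟩ := Prod.mk.inj e3
      refine Prod.ext (Prod.ext (TrivSqZeroExt.ext s3 s1) (TrivSqZeroExt.ext s4 s2)) ?_
      exact hinj _ (Finset.mem_product.1 hc).2 _ (Finset.mem_product.1 hd).2 (Prod.mk.inj e2).1
  have hm : (P.card : ℝ) = ∑ q ∈ Q, ((Pq q).card : ℝ) := by
    exact_mod_cast Finset.card_eq_sum_card_image π P
  have hmQ : Q.card ≤ P.card := Finset.card_image_le
  set m : ℝ := (P.card : ℝ) with hmdef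
  set n : ℝ := (L.card : ℝ) with hndef
  have hm0 : 0 ≤ m := Nat.cast_nonneg _
  have hn0 : 0 ≤ n := Nat.cast_nonneg _
  set T : ℝ := m ^ (2/3 : ℝ) * n ^ (2/3 : ℝ) + m + n with hT
  have hpos : 0 ≤ m ^ (2/3 : ℝ) * n ^ (2/3 : ℝ) := by positivity
  have hT0 : 0 ≤ T := by positivity
  have hk : ∑ q ∈ Q, ((Lq q).card : ℝ) ≤ 8 * T := by
    have hle : ∑ q ∈ Q, (Lq q).card ≤
        rinc Q (L.image fun l => (TrivSqZeroExt.fst (A l), TrivSqZeroExt.fst (B l))) := by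
      have : ∑ q ∈ Q, (Lq q).card = ((Q ×ˢ L).filter fun c =>
          c.1.2 = TrivSqZeroExt.fst (A c.2) * c.1.1 + TrivSqZeroExt.fst (B c.2)).card := by
        rw [Finset.card_filter, Finset.sum_product]
        apply Finset.sum_congr rfl
        intro q _
        exact Finset.card_filter _ _
      rw [this]
      unfold rinc
      apply Finset.card_le_card_of_injOn
        (fun c => (c.1, (TrivSqZeroExt.fst (A c.2), TrivSqZeroExt.fst (B c.2))))
      · intro c hc
        obtain ⟨hc, hi⟩ := Finset.mem_filter.1 hc
        obtain ⟨hP, hL⟩ := Finset.mem_product.1 hc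
        exact Finset.mem_coe.2 (Finset.mem_filter.2 ⟨Finset.mem_product.2 ⟨hP,
          Finset.mem_image.2 ⟨c.2, hL, rfl⟩⟩, hi⟩)
      · intro c hc d hd hcd
        obtain ⟨hc, -⟩ := Finset.mem_filter.1 hc
        obtain ⟨hd, -⟩ := Finset.mem_filter.1 hd
        obtain ⟨e1, e2⟩ := Prod.mk.inj hcd
        exact Prod.ext e1 (hinj _ (Finset.mem_product.1 hc).2 _ (Finset.mem_product.1 hd).2
          (Prod.mk.inj e2).1)
    have hle' : ∑ q ∈ Q, ((Lq q).card : ℝ) ≤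
        rinc Q (L.image fun l => (TrivSqZeroExt.fst (A l), TrivSqZeroExt.fst (B l))) := by
      exact_mod_cast hle
    exact hle'.trans (real_st' _ _ P.card L.card hmQ Finset.card_image_le)
  have hk2 : ∑ q ∈ Q, ((Lq q).card : ℝ) ^ 2 ≤ 8 * T + n ^ 2 := by
    have hoff : ∑ q ∈ Q, (Lq q).offDiag.card ≤ L.card * L.card := by
      rw [← Finset.card_biUnion, ← Finset.card_product]
      · apply Finset.card_le_card
        intro c hc
        obtain ⟨q, -, hq⟩ := Finset.mem_biUnion.1 hc
        obtain ⟨c1, c2, -⟩ := Finset.mem_offDiag.1 hq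
        exact Finset.mem_product.2 ⟨(Finset.mem_filter.1 c1).1, (Finset.mem_filter.1 c2).1⟩
      · intro q _ q' _ hne
        rw [Function.onFun, Finset.disjoint_left]
        intro c hc hc'
        obtain ⟨c1, c2, c3⟩ := Finset.mem_offDiag.1 hc
        obtain ⟨d1, d2, -⟩ := Finset.mem_offDiag.1 hc'
        obtain ⟨l1, c1⟩ := Finset.mem_filter.1 c1
        obtain ⟨l2, c2⟩ := Finset.mem_filter.1 c2
        obtain ⟨-, d1⟩ := Finset.mem_filter.1 d1
        obtain ⟨-, d2⟩ := Finset.mem_filter.1 d2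
        have ha : TrivSqZeroExt.fst (A c.1) - TrivSqZeroExt.fst (A c.2) ≠ 0 := by
          intro h
          exact c3 (hinj _ l1 _ l2 (by linarith))
        have hx : q.1 = q'.1 := by
          have : (TrivSqZeroExt.fst (A c.1) - TrivSqZeroExt.fst (A c.2)) * (q.1 - q'.1) = 0 := by
            linarith
          rcases mul_eq_zero.1 this with h | h
          · exact absurd h ha
          · linarith
        exact hne (Prod.ext hx (by rw [c1, d1, hx]))
    have hsq : ∀ q ∈ Q, ((Lq q).card : ℝ) ^ 2 = (Lq q).card + ((Lq q).offDiag.card : ℝ) := by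
      intro q _
      rw [Finset.offDiag_card, Nat.cast_sub (Nat.le_mul_self _)]
      push_cast
      ring
    rw [Finset.sum_congr rfl hsq, Finset.sum_add_distrib]
    have hoff' : ∑ q ∈ Q, ((Lq q).offDiag.card : ℝ) ≤ n * n := by
      rw [hndef]
      exact_mod_cast hoff
    nlinarith
  have hh := holder_sum Q (fun q => ((Pq q).card : ℝ)) (fun q => ((Lq q).card : ℝ))
    (fun q _ => Nat.cast_nonneg _) (fun q _ => Nat.cast_nonneg _)
  rw [← hm] at hh
  have hX : ∑ q ∈ Q, ((Pq q).card : ℝ) ^ (2/3 : ℝ) * ((Lq q).card : ℝ) ^ (2/3 : ℝ) ≤ 3 * T := by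
    exact analytic m n T _ _ hm0 hn0 hT (Finset.sum_nonneg fun _ _ => sq_nonneg _) hk2 hh
  have h3 : (dinc P L A B : ℝ) ≤ ∑ q ∈ Q, 8 * (((Pq q).card : ℝ) ^ (2/3 : ℝ) *
      ((Lq q).card : ℝ) ^ (2/3 : ℝ) + (Pq q).card + (Lq q).card) := by
    rw [h1]
    push_cast
    apply Finset.sum_le_sum
    intro q hq
    have : ((((P ×ˢ L).filter fun c => c.1.2 = A c.2 * c.1.1 + B c.2).filter
      fun c => π c.1 = q).card : ℝ) ≤ rinc ((Pq q).image σ) ((Lq q).image (τ q)) := by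
      exact_mod_cast h2 q hq
    exact this.trans (real_st' _ _ _ _ Finset.card_image_le Finset.card_image_le)
  rw [← Finset.mul_sum, Finset.sum_add_distrib, Finset.sum_add_distrib, ← hm] at h3
  linarith

lemma exists_coloring {ι : Type} (L : Finset ι) (g : ι → ℝ) (K : ℕ)
    (hK : ∀ r, (L.filter fun l => g l = r).card ≤ K) :
    ∃ c : ι → ℕ, (∀ l ∈ L, c l < K) ∧
      ∀ l ∈ L, ∀ l' ∈ L, c l = c l' → g l = g l' → l = l' := by
  have key : ∀ r : ℝ, ∃ c : ι → ℕ, (∀ l ∈ L, g l = r → c l < K) ∧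
      ∀ l ∈ L, ∀ l' ∈ L, g l = r → g l' = r → c l = c l' → l = l' := by
    intro r
    let F := L.filter fun l => g l = r
    refine ⟨fun l => if h : l ∈ F then (F.equivFin ⟨l, h⟩ : ℕ) else 0, ?_, ?_⟩
    · intro l hl hg
      have hF : l ∈ F := Finset.mem_filter.2 ⟨hl, hg⟩
      simp only [dif_pos hF]
      exact lt_of_lt_of_le (F.equivFin ⟨l, hF⟩).2 (hK r)
    · intro l hl l' hl' hg hg' h
      have hF : l ∈ F := Finset.mem_filter.2 ⟨hl, hg⟩
      have hF' : l' ∈ F := Finset.mem_filter.2 ⟨hl', hg'⟩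
      simp only [dif_pos hF, dif_pos hF'] at h
      have := F.equivFin.injective (Fin.ext h)
      exact congrArg Subtype.val this
  choose c hc1 hc2 using key
  refine ⟨fun l => c (g l) l, fun l hl => hc1 _ l hl rfl, ?_⟩
  intro l hl l' hl' h hg
  refine hc2 (g l) l hl l' hl' rfl hg.symm ?_
  simp only at h
  rw [h, hg]

theorem dual_colored {ι : Type} (P : Finset (DualNumber ℝ × DualNumber ℝ)) (L : Finset ι)
    (A B : ι → DualNumber ℝ) (K : ℕ)
    (hK : ∀ r, (L.filter fun l => TrivSqZeroExt.fst (A l) = r).card ≤ K) :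
    (dinc P L A B : ℝ) ≤ 96 * ((P.card : ℝ) ^ (2/3 : ℝ) *
      ((L.card : ℝ) ^ (2/3 : ℝ) * (K : ℝ) ^ (1/3 : ℝ)) + P.card * K + L.card) := by
  obtain ⟨c, hc1, hc2⟩ := exists_coloring L (fun l => TrivSqZeroExt.fst (A l)) K hK
  let Li : ℕ → Finset ι := fun i => L.filter fun l => c l = i
  have h1 : dinc P L A B = ∑ i ∈ Finset.range K, dinc P (Li i) A B := by
    have : dinc P L A B = ∑ i ∈ Finset.range K,
        (((P ×ˢ L).filter fun d => d.1.2 = A d.2 * d.1.1 + B d.2).filter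
          fun d => c d.2 = i).card := by
      apply Finset.card_eq_sum_card_fiberwise
      intro d hd
      have := (Finset.mem_product.1 (Finset.mem_filter.1 hd).1).2
      exact Finset.mem_coe.2 (Finset.mem_range.2 (hc1 _ this))
    rw [this]
    apply Finset.sum_congr rfl
    intro i _
    unfold dinc
    congr 1
    ext d
    simp only [Finset.mem_filter, Finset.mem_product, Li]
    tauto
  have hn : (L.card : ℝ) = ∑ i ∈ Finset.range K, ((Li i).card : ℝ) := by
    have : L.card = ∑ i ∈ Finset.range K, (Li i).card := by
      apply Finset.card_eq_sum_card_fiberwise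
      intro l hl
      exact Finset.mem_coe.2 (Finset.mem_range.2 (hc1 _ hl))
    exact_mod_cast this
  have h2 : (dinc P L A B : ℝ) ≤ ∑ i ∈ Finset.range K, 96 * ((P.card : ℝ) ^ (2/3 : ℝ) *
      ((Li i).card : ℝ) ^ (2/3 : ℝ) + P.card + (Li i).card) := by
    rw [h1]
    push_cast
    apply Finset.sum_le_sum
    intro i _
    apply dual_distinct
    intro l hl l' hl' h
    obtain ⟨hl, e⟩ := Finset.mem_filter.1 hl
    obtain ⟨hl', e'⟩ := Finset.mem_filter.1 hl'
    exact hc2 l hl l' hl' (e.trans e'.symm) h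
  have h3 := holder_sum (Finset.range K) (fun i => ((Li i).card : ℝ)) (fun _ => (1 : ℝ))
    (fun i _ => Nat.cast_nonneg _) (fun _ _ => zero_le_one)
  rw [← hn] at h3
  simp only [Real.one_rpow, mul_one, one_pow, Finset.sum_const, Finset.card_range, nsmul_eq_mul]
    at h3
  refine h2.trans ?_
  rw [← Finset.mul_sum, Finset.sum_add_distrib, Finset.sum_add_distrib, ← hn, ← Finset.mul_sum,
    Finset.sum_const, Finset.card_range, nsmul_eq_mul]
  have h4 : (P.card : ℝ) ^ (2/3 : ℝ) * ∑ i ∈ Finset.range K, ((Li i).card : ℝ) ^ (2/3 : ℝ) ≤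
      (P.card : ℝ) ^ (2/3 : ℝ) * ((L.card : ℝ) ^ (2/3 : ℝ) * (K : ℝ) ^ (1/3 : ℝ)) := by
    gcongr
  linarith

/-- The slope of a dual line (junk value `0` for `x = b`). -/
noncomputable def DualLine.slo : DualLine → DualNumber ℝ
  | .slope a _ => a
  | .vert _ => 0

/-- The intercept of a dual line. -/
noncomputable def DualLine.icp : DualLine → DualNumber ℝ
  | .slope _ b => b
  | .vert b => b

lemma vert_inc (P : Finset (DualNumber ℝ × DualNumber ℝ)) (L : Finset DualLine)
    (hL : ∀ l ∈ L, l.slopeRe = none) :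
    ((P ×ˢ L).filter fun pl => pl.1 ∈ pl.2.pts).card ≤ P.card := by
  apply Finset.card_le_card_of_injOn Prod.fst
  · intro c hc
    exact (Finset.mem_product.1 (Finset.mem_filter.1 hc).1).1
  · rintro ⟨p, l⟩ hc ⟨p', l'⟩ hc' h
    obtain ⟨m1, m2⟩ := Finset.mem_filter.1 hc
    obtain ⟨n1, n2⟩ := Finset.mem_filter.1 hc'
    have m3 := hL _ (Finset.mem_product.1 m1).2
    have n3 := hL _ (Finset.mem_product.1 n1).2
    change p = p' at h
    subst h
    cases l with
    | slope a b => simp [DualLine.slopeRe] at m3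
    | vert b =>
      cases l' with
      | slope a b => simp [DualLine.slopeRe] at n3
      | vert b' =>
        change p.1 = b at m2
        change p.1 = b' at n2
        rw [← m2, ← n2]

/-- **Szemerédi–Trotter-type bound in the dual plane.**
For `0 ≤ α ≤ 1` and `ρ > 0` there is `C > 0` such that for every finite set `𝒫` of `m` points
and every finite set `ℒ` of `n` lines in `𝔻²` in which, for every `r ∈ ℝ`, at most `n^α` lines
of the form `y = a x + b` have `Re(a) = r`, we have
`I(𝒫,ℒ) ≤ C (m^(2/3+ρ) n^((2+α)/3) + m n^α + n)`. -/
theorem dual_szemeredi_trotter (α ρ : ℝ) (hα0 : 0 ≤ α) (hα1 : α ≤ 1) (hρ : 0 < ρ) :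
    ∃ C : ℝ, 0 < C ∧ ∀ (P : Finset (DualNumber ℝ × DualNumber ℝ)) (L : Finset DualLine),
      (∀ r : ℝ, ((L.filter fun l => l.slopeRe = some r).card : ℝ) ≤ (L.card : ℝ) ^ α) →
      (inc P L : ℝ) ≤ C * ((P.card : ℝ) ^ (2/3 + ρ) * (L.card : ℝ) ^ ((2 + α)/3)
        + (P.card : ℝ) * (L.card : ℝ) ^ α + (L.card : ℝ)) := by
  refine ⟨97, by norm_num, ?_⟩
  intro P L hL
  rcases L.eq_empty_or_nonempty with rfl | hne
  · have : inc P ∅ = 0 := by simp [inc]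
    rw [this]
    push_cast
    positivity
  have hn1 : (1 : ℝ) ≤ L.card := by exact_mod_cast hne.card_pos
  have hna : (1 : ℝ) ≤ (L.card : ℝ) ^ α := Real.one_le_rpow hn1 hα0
  let S := L.filter fun l => l.slopeRe ≠ none
  let W := L.filter fun l => l.slopeRe = none
  have hsplit : inc P L ≤ dinc P S DualLine.slo DualLine.icp + P.card := by
    refine le_trans ?_ (Nat.add_le_add_left (vert_inc P W
      (fun l hl => (Finset.mem_filter.1 hl).2)) _)
    unfold inc dinc
    refine le_trans (Finset.card_le_card ?_) (Finset.card_union_le _ _)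
    rintro ⟨p, l⟩ hc
    obtain ⟨h1, h2⟩ := Finset.mem_filter.1 hc
    obtain ⟨hp, hl⟩ := Finset.mem_product.1 h1
    cases l with
    | slope a b =>
      refine Finset.mem_union_left _ (Finset.mem_filter.2 ⟨Finset.mem_product.2 ⟨hp, ?_⟩, h2⟩)
      exact Finset.mem_filter.2 ⟨hl, by simp [DualLine.slopeRe]⟩
    | vert b =>
      refine Finset.mem_union_right _ (Finset.mem_filter.2 ⟨Finset.mem_product.2 ⟨hp, ?_⟩, h2⟩)
      exact Finset.mem_filter.2 ⟨hl, by simp [DualLine.slopeRe]⟩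
  let K := ⌊(L.card : ℝ) ^ α⌋₊
  have hKle : (K : ℝ) ≤ (L.card : ℝ) ^ α := Nat.floor_le (by positivity)
  have hK : ∀ r, (S.filter fun l => TrivSqZeroExt.fst (DualLine.slo l) = r).card ≤ K := by
    intro r
    apply Nat.le_floor
    refine le_trans ?_ (hL r)
    norm_cast
    apply Finset.card_le_card
    intro l hl
    obtain ⟨h1, h2⟩ := Finset.mem_filter.1 hl
    obtain ⟨h1, h3⟩ := Finset.mem_filter.1 h1
    refine Finset.mem_filter.2 ⟨h1, ?_⟩
    cases l with
    | slope a b =>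
      change TrivSqZeroExt.fst a = r at h2
      simp [DualLine.slopeRe, DRe, h2]
    | vert b => simp [DualLine.slopeRe] at h3
  have hmain := dual_colored P S DualLine.slo DualLine.icp K hK
  have hSL : (S.card : ℝ) ≤ L.card := by exact_mod_cast Finset.card_filter_le _ _
  have hsplit' : (inc P L : ℝ) ≤ dinc P S DualLine.slo DualLine.icp + P.card := by
    exact_mod_cast hsplit
  have hm : (P.card : ℝ) ^ (2/3 : ℝ) ≤ (P.card : ℝ) ^ (2/3 + ρ) := by
    rcases P.eq_empty_or_nonempty with rfl | hP
    · simp only [Finset.card_empty, Nat.cast_zero]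
      rw [Real.zero_rpow (by norm_num), Real.zero_rpow (by positivity)]
    · exact Real.rpow_le_rpow_of_exponent_le (by exact_mod_cast hP.card_pos) (by linarith)
  have hLn : (S.card : ℝ) ^ (2/3 : ℝ) * (K : ℝ) ^ (1/3 : ℝ) ≤ (L.card : ℝ) ^ ((2 + α)/3) := by
    calc (S.card : ℝ) ^ (2/3 : ℝ) * (K : ℝ) ^ (1/3 : ℝ)
        ≤ (L.card : ℝ) ^ (2/3 : ℝ) * ((L.card : ℝ) ^ α) ^ (1/3 : ℝ) := by gcongr
      _ = (L.card : ℝ) ^ ((2 + α)/3) := by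
        rw [← Real.rpow_mul (by linarith), ← Real.rpow_add (by linarith)]
        congr 1
        ring
  have t1 : (P.card : ℝ) ^ (2/3 : ℝ) * ((S.card : ℝ) ^ (2/3 : ℝ) * (K : ℝ) ^ (1/3 : ℝ)) ≤
      (P.card : ℝ) ^ (2/3 + ρ) * (L.card : ℝ) ^ ((2 + α)/3) := by gcongr
  have t2 : (P.card : ℝ) * K ≤ P.card * (L.card : ℝ) ^ α := by gcongr
  have t3 : (P.card : ℝ) ≤ P.card * (L.card : ℝ) ^ α :=
    le_mul_of_one_le_right (Nat.cast_nonneg _) hna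
  have t4 : 0 ≤ (P.card : ℝ) ^ (2/3 + ρ) * (L.card : ℝ) ^ ((2 + α)/3) := by positivity
  linarith
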